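/- In the Φ-tensor construction, for every tensor T ∈ A⊗B⊗C one has min R(T^{Σ_θ} mod (0, 0, M)) = min R(T mod (0, 0, ⟨w⟩)), where T^{Σ_θ} ∈ (A⊗(ℂ^σ)^{⊗θ})⊗(B⊗(ℂ^σ)^{⊗θ})⊗(C⊗(ℂ^σ)^{⊗θ}) is the Σ_θ-clone of T and M ⊆ (A⊗(ℂ^σ)^{⊗θ})⊗(B⊗(ℂ^σ)^{⊗θ}) is used for modifications in the third direction. -/

import Mathlib

open TensorProduct

/-- `(ℂ^σ)^{⊗θ}`, realized as the space of functions on multi-indices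
`(α₁,…,α_θ) ∈ (Fin σ)^θ`. -/
abbrev Wsp (θ σ : ℕ) : Type := (Fin θ → Fin σ) → ℂ

/-- The canonical basis vector `e_{α₁} ⊗ ⋯ ⊗ e_{α_θ}` of `(ℂ^σ)^{⊗θ}`. -/
noncomputable def bvec {θ σ : ℕ} (φ : Fin θ → Fin σ) : Wsp θ σ := Pi.single φ 1

/-- Selection of one of the two components of a pair in `Fin σ × Fin σ` (the pair encodes an
element `s ∈ {0,…,σ²−1}` via `s = (u(s,1)−1)σ + (u(s,2)−1)`; `sel p true = u(s,1)`,
`sel p false = u(s,2)`). -/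
def sel {σ : ℕ} (p : Fin σ × Fin σ) (b : Bool) : Fin σ := if b then p.1 else p.2

section Phi

variable {A B : Type*} [AddCommGroup A] [Module ℂ A] [AddCommGroup B] [Module ℂ B]

/-- The Φ-tensor `M^Φ` associated to families `a`, `b` and the functions `π_i`
(here `π i : Fin θ → Bool`, with `true`/`false` standing for the values `1`/`2`, and
`!(π j)` standing for `3 − π_j`). -/
noncomputable def PhiTensor {r θ σ : ℕ} (a : Fin r → A) (b : Fin r → B)
    (π : Fin r → Fin θ → Bool) (Φ : Fin θ → Fin σ × Fin σ) :
    (A ⊗[ℂ] Wsp θ σ) ⊗[ℂ] (B ⊗[ℂ] Wsp θ σ) :=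
  (∑ i, a i ⊗ₜ[ℂ] bvec (fun γ => sel (Φ γ) (π i γ))) ⊗ₜ[ℂ]
    (∑ j, b j ⊗ₜ[ℂ] bvec (fun δ => sel (Φ δ) (!(π j δ))))

/-- The `(i,j)`-block `M(a_i^* ⊗ b_j^*) ∈ W ⊗ W` of `M ∈ (A⊗W)⊗(B⊗W)`. -/
noncomputable def blockOf {θ σ : ℕ} (f : Module.Dual ℂ A) (g : Module.Dual ℂ B)
    (M : (A ⊗[ℂ] Wsp θ σ) ⊗[ℂ] (B ⊗[ℂ] Wsp θ σ)) : Wsp θ σ ⊗[ℂ] Wsp θ σ :=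
  TensorProduct.map
    ((TensorProduct.lid ℂ (Wsp θ σ)).toLinearMap ∘ₗ TensorProduct.map f LinearMap.id)
    ((TensorProduct.lid ℂ (Wsp θ σ)).toLinearMap ∘ₗ TensorProduct.map g LinearMap.id) M

/-- Evaluation of an element of `W ⊗ W` against the pair of dual basis vectors `φ^* ⊗ ψ^*`. -/
noncomputable def evalPair {θ σ : ℕ} (φ ψ : Fin θ → Fin σ) :
    Wsp θ σ ⊗[ℂ] Wsp θ σ →ₗ[ℂ] ℂ :=
  TensorProduct.lift ((LinearMap.mul ℂ ℂ).compl₁₂ (LinearMap.proj φ) (LinearMap.proj ψ))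

/-- The set `𝓤` of unit matrices corresponding to entries that are nonzero in some
off-diagonal block of some Φ-tensor. -/
def Uset {r θ σ : ℕ} (a : Fin r → A) (b : Fin r → B) (π : Fin r → Fin θ → Bool)
    (astar : Fin r → Module.Dual ℂ A) (bstar : Fin r → Module.Dual ℂ B) :
    Set ((A ⊗[ℂ] Wsp θ σ) ⊗[ℂ] (B ⊗[ℂ] Wsp θ σ)) :=
  {x | ∃ i j : Fin r, i ≠ j ∧ ∃ φ ψ : Fin θ → Fin σ,
    (∃ Φ : Fin θ → Fin σ × Fin σ,
      evalPair φ ψ (blockOf (astar i) (bstar j) (PhiTensor a b π Φ)) ≠ 0) ∧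
    x = (a i ⊗ₜ[ℂ] bvec φ) ⊗ₜ[ℂ] (b j ⊗ₜ[ℂ] bvec ψ)}

/-- The space `𝓜 = span(𝓕 ∪ 𝓤)`, where `𝓕` is the set of all Φ-tensors. -/
noncomputable def Msp {r θ σ : ℕ} (a : Fin r → A) (b : Fin r → B)
    (π : Fin r → Fin θ → Bool)
    (astar : Fin r → Module.Dual ℂ A) (bstar : Fin r → Module.Dual ℂ B) :
    Submodule ℂ ((A ⊗[ℂ] Wsp θ σ) ⊗[ℂ] (B ⊗[ℂ] Wsp θ σ)) :=
  Submodule.span ℂ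
    (Set.range (PhiTensor a b π (σ := σ)) ∪ Uset a b π astar bstar)

end Phi

/-- The rank of a 3-tensor `T ∈ A ⊗ B ⊗ C`. -/
noncomputable def tRank3 {A B C : Type*} [AddCommGroup A] [Module ℂ A]
    [AddCommGroup B] [Module ℂ B] [AddCommGroup C] [Module ℂ C]
    (T : A ⊗[ℂ] (B ⊗[ℂ] C)) : ℕ :=
  sInf {r : ℕ | ∃ (a : Fin r → A) (b : Fin r → B) (c : Fin r → C),
    T = ∑ i, a i ⊗ₜ[ℂ] (b i ⊗ₜ[ℂ] c i)}

section Mods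

variable {A B C V : Type*} [AddCommGroup A] [Module ℂ A]
  [AddCommGroup B] [Module ℂ B] [AddCommGroup C] [Module ℂ C]
  [AddCommGroup V] [Module ℂ V]

/-- Modifications of `T` by `(0, 0, W_C)`. -/
def modSetC (T : A ⊗[ℂ] (B ⊗[ℂ] C)) (W : Submodule ℂ (A ⊗[ℂ] B)) :
    Set (A ⊗[ℂ] (B ⊗[ℂ] C)) :=
  {T' | ∃ X ∈ Submodule.span ℂ
      {x | ∃ w ∈ W, ∃ c : C, x = (TensorProduct.assoc ℂ A B C) (w ⊗ₜ[ℂ] c)},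
    T' = T + X}

/-- `min R(T mod (0,0,W_C))`. -/
noncomputable def minModRankC (T : A ⊗[ℂ] (B ⊗[ℂ] C)) (W : Submodule ℂ (A ⊗[ℂ] B)) : ℕ :=
  sInf (tRank3 '' modSetC T W)

/-- Kronecker-product regrouping map for 3-tensors: `T ↦ T ⊠ (S ⊗ S ⊗ S)`;
for `S = S_Σ` the sum of the basis vectors, this sends `T` to its `Σ`-clone `T^Σ`. -/
noncomputable def cloneMap3 (S : V) :
    (A ⊗[ℂ] (B ⊗[ℂ] C)) →ₗ[ℂ] (A ⊗[ℂ] V) ⊗[ℂ] ((B ⊗[ℂ] V) ⊗[ℂ] (C ⊗[ℂ] V)) :=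
  (TensorProduct.congr (LinearEquiv.refl ℂ (A ⊗[ℂ] V))
      (TensorProduct.tensorTensorTensorComm ℂ B C V V)).toLinearMap ∘ₗ
    (TensorProduct.tensorTensorTensorComm ℂ A (B ⊗[ℂ] C) V (V ⊗[ℂ] V)).toLinearMap ∘ₗ
    (TensorProduct.mk ℂ (A ⊗[ℂ] (B ⊗[ℂ] C)) (V ⊗[ℂ] (V ⊗[ℂ] V))).flip (S ⊗ₜ[ℂ] (S ⊗ₜ[ℂ] S))

end Mods

section Rank

variable {A B C A' B' C' : Type*} [AddCommGroup A] [Module ℂ A] [AddCommGroup B] [Module ℂ B]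
  [AddCommGroup C] [Module ℂ C] [AddCommGroup A'] [Module ℂ A'] [AddCommGroup B'] [Module ℂ B']
  [AddCommGroup C'] [Module ℂ C']

theorem tRank3_le_card {ι : Type*} [Fintype ι] {T : A ⊗[ℂ] (B ⊗[ℂ] C)}
    (x : ι → A) (y : ι → B) (z : ι → C) (hT : T = ∑ i, x i ⊗ₜ[ℂ] (y i ⊗ₜ[ℂ] z i)) :
    tRank3 T ≤ Fintype.card ι := by
  refine Nat.sInf_le ⟨x ∘ (Fintype.equivFin ι).symm, y ∘ (Fintype.equivFin ι).symm,
    z ∘ (Fintype.equivFin ι).symm, ?_⟩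
  rw [hT]
  exact ((Fintype.equivFin ι).symm.sum_comp fun i => x i ⊗ₜ[ℂ] (y i ⊗ₜ[ℂ] z i)).symm

theorem exists_eq_sum_simple (T : A ⊗[ℂ] (B ⊗[ℂ] C)) :
    ∃ (n : ℕ) (x : Fin n → A) (y : Fin n → B) (z : Fin n → C),
      T = ∑ i, x i ⊗ₜ[ℂ] (y i ⊗ₜ[ℂ] z i) := by
  induction T with
  | zero => exact ⟨0, 0, 0, 0, by simp⟩
  | tmul u v =>
    induction v with
    | zero => exact ⟨0, 0, 0, 0, by simp⟩
    | tmul v w => exact ⟨1, fun _ => u, fun _ => v, fun _ => w, by simp⟩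
    | add v w hv hw =>
      obtain ⟨m, x, y, z, hv⟩ := hv
      obtain ⟨n, x', y', z', hw⟩ := hw
      exact ⟨m + n, Fin.append x x', Fin.append y y', Fin.append z z', by
        simp [Fin.sum_univ_add, tmul_add, hv, hw]⟩
  | add v w hv hw =>
    obtain ⟨m, x, y, z, hv⟩ := hv
    obtain ⟨n, x', y', z', hw⟩ := hw
    exact ⟨m + n, Fin.append x x', Fin.append y y', Fin.append z z', by
      simp [Fin.sum_univ_add, hv, hw]⟩

theorem exists_eq_sum_tRank3 (T : A ⊗[ℂ] (B ⊗[ℂ] C)) :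
    ∃ (x : Fin (tRank3 T) → A) (y : Fin (tRank3 T) → B) (z : Fin (tRank3 T) → C),
      T = ∑ i, x i ⊗ₜ[ℂ] (y i ⊗ₜ[ℂ] z i) :=
  Nat.sInf_mem (s := {r : ℕ | ∃ (a : Fin r → A) (b : Fin r → B) (c : Fin r → C),
    T = ∑ i, a i ⊗ₜ[ℂ] (b i ⊗ₜ[ℂ] c i)}) (exists_eq_sum_simple T)

theorem tRank3_map_le (p : A →ₗ[ℂ] A') (q : B →ₗ[ℂ] B') (s : C →ₗ[ℂ] C')
    (T : A ⊗[ℂ] (B ⊗[ℂ] C)) :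
    tRank3 (TensorProduct.map p (TensorProduct.map q s) T) ≤ tRank3 T := by
  obtain ⟨x, y, z, h⟩ := exists_eq_sum_tRank3 T
  simpa using tRank3_le_card (T := TensorProduct.map p (TensorProduct.map q s) T)
    (p ∘ x) (q ∘ y) (s ∘ z) (by conv_lhs => rw [h]
                                simp)

theorem tRank3_le_finrank_mul [FiniteDimensional ℂ A] [FiniteDimensional ℂ B]
    [FiniteDimensional ℂ C] (T : A ⊗[ℂ] (B ⊗[ℂ] C)) :
    tRank3 T ≤ Module.finrank ℂ A * Module.finrank ℂ B * Module.finrank ℂ C := by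
  let eA := Module.finBasis ℂ A
  let eB := Module.finBasis ℂ B
  let eC := Module.finBasis ℂ C
  let e := eA.tensorProduct (eB.tensorProduct eC)
  refine (tRank3_le_card (fun i => e.repr T i • eA i.1) (fun i => eB i.2.1) (fun i => eC i.2.2)
    ?_).trans (by simp [mul_assoc])
  conv_lhs => rw [← e.sum_repr T]
  refine Finset.sum_congr rfl fun i _ => ?_
  rw [← smul_tmul', Module.Basis.tensorProduct_apply', Module.Basis.tensorProduct_apply']

theorem minModRankC_le {T T' : A ⊗[ℂ] (B ⊗[ℂ] C)} {W : Submodule ℂ (A ⊗[ℂ] B)}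
    (h : T' ∈ modSetC T W) : minModRankC T W ≤ tRank3 T' :=
  Nat.sInf_le ⟨T', h, rfl⟩

theorem self_mem_modSetC (T : A ⊗[ℂ] (B ⊗[ℂ] C)) (W : Submodule ℂ (A ⊗[ℂ] B)) :
    T ∈ modSetC T W :=
  ⟨0, zero_mem _, by simp⟩

theorem exists_tRank3_eq_minModRankC (T : A ⊗[ℂ] (B ⊗[ℂ] C)) (W : Submodule ℂ (A ⊗[ℂ] B)) :
    ∃ T' ∈ modSetC T W, tRank3 T' = minModRankC T W :=
  Nat.sInf_mem (s := tRank3 '' modSetC T W) ⟨_, T, self_mem_modSetC T W, rfl⟩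

/-- Contraction of a 3-tensor with functionals in the first two directions. -/
noncomputable def contract (f : Module.Dual ℂ A) (g : Module.Dual ℂ B) :
    A ⊗[ℂ] (B ⊗[ℂ] C) →ₗ[ℂ] C :=
  (TensorProduct.lid ℂ C).toLinearMap ∘ₗ TensorProduct.map f
    ((TensorProduct.lid ℂ C).toLinearMap ∘ₗ TensorProduct.map g LinearMap.id)

@[simp] theorem contract_tmul (f : Module.Dual ℂ A) (g : Module.Dual ℂ B) (x : A) (y : B) (z : C) :
    contract f g (x ⊗ₜ[ℂ] (y ⊗ₜ[ℂ] z)) = f x • g y • z := by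
  simp [contract, smul_comm (g y)]

theorem contract_assoc (f : Module.Dual ℂ A) (g : Module.Dual ℂ B) (m : A ⊗[ℂ] B) (z : C) :
    contract f g (TensorProduct.assoc ℂ A B C (m ⊗ₜ[ℂ] z)) =
      TensorProduct.dualDistrib ℂ A B (f ⊗ₜ[ℂ] g) m • z := by
  induction m with
  | zero => simp
  | tmul x y => simp [mul_smul]
  | add x y hx hy => simp only [add_tmul, map_add, hx, hy, add_smul]

theorem contract_map (f : Module.Dual ℂ A') (g : Module.Dual ℂ B') (p : A →ₗ[ℂ] A')
    (q : B →ₗ[ℂ] B') (s : C →ₗ[ℂ] C') (T : A ⊗[ℂ] (B ⊗[ℂ] C)) :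
    contract f g (TensorProduct.map p (TensorProduct.map q s) T) =
      s (contract (f ∘ₗ p) (g ∘ₗ q) T) := by
  obtain ⟨n, x, y, z, rfl⟩ := exists_eq_sum_simple T
  simp

theorem map_assoc (p : A →ₗ[ℂ] A') (q : B →ₗ[ℂ] B') (s : C →ₗ[ℂ] C') (m : A ⊗[ℂ] B) (z : C) :
    TensorProduct.map p (TensorProduct.map q s) (TensorProduct.assoc ℂ A B C (m ⊗ₜ[ℂ] z)) =
      TensorProduct.assoc ℂ A' B' C' (TensorProduct.map p q m ⊗ₜ[ℂ] s z) := by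
  induction m with
  | zero => simp
  | tmul x y => simp
  | add x y hx hy => simp only [add_tmul, map_add, hx, hy]

theorem contract_eq_zero {f : Module.Dual ℂ A} {g : Module.Dual ℂ B} {W : Submodule ℂ (A ⊗[ℂ] B)}
    (h : ∀ m ∈ W, TensorProduct.dualDistrib ℂ A B (f ⊗ₜ[ℂ] g) m = 0) {X : A ⊗[ℂ] (B ⊗[ℂ] C)}
    (hX : X ∈ Submodule.span ℂ
      {x | ∃ w ∈ W, ∃ c : C, x = (TensorProduct.assoc ℂ A B C) (w ⊗ₜ[ℂ] c)}) :
    contract f g X = 0 := by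
  induction hX using Submodule.span_induction with
  | mem x hx =>
    obtain ⟨m, hm, c, rfl⟩ := hx
    rw [contract_assoc, h m hm, zero_smul]
  | zero => simp
  | add x y _ _ hx hy => simp [hx, hy]
  | smul k x _ hx => simp [hx]

theorem map_mem_span_assoc {p : A →ₗ[ℂ] A'} {q : B →ₗ[ℂ] B'} (s : C →ₗ[ℂ] C')
    {W : Submodule ℂ (A ⊗[ℂ] B)} {W' : Submodule ℂ (A' ⊗[ℂ] B')}
    (h : W ≤ W'.comap (TensorProduct.map p q)) {X : A ⊗[ℂ] (B ⊗[ℂ] C)}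
    (hX : X ∈ Submodule.span ℂ
      {x | ∃ w ∈ W, ∃ c : C, x = (TensorProduct.assoc ℂ A B C) (w ⊗ₜ[ℂ] c)}) :
    TensorProduct.map p (TensorProduct.map q s) X ∈ Submodule.span ℂ
      {x | ∃ w ∈ W', ∃ c : C', x = (TensorProduct.assoc ℂ A' B' C') (w ⊗ₜ[ℂ] c)} := by
  induction hX using Submodule.span_induction with
  | mem x hx =>
    obtain ⟨m, hm, c, rfl⟩ := hx
    exact Submodule.subset_span ⟨_, h hm, s c, map_assoc ..⟩
  | zero => simp
  | add x y _ _ hx hy => rw [map_add]; exact add_mem hx hy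
  | smul k x _ hx => rw [map_smul]; exact Submodule.smul_mem _ _ hx

/-- Elements of `⟨w⟩ + span {a_i ⊗ b_j : i ≠ j}`, tensored with `C`, are determined modulo
`⟨w⟩ ⊗ C` by their off-diagonal contractions. -/
theorem mem_span_assoc_of_contract_eq_zero {r : ℕ} {a : Fin r → A} {b : Fin r → B}
    {astar : Fin r → Module.Dual ℂ A} {bstar : Fin r → Module.Dual ℂ B}
    (hastar : ∀ i k, astar i (a k) = if i = k then 1 else 0)
    (hbstar : ∀ j k, bstar j (b k) = if j = k then 1 else 0)
    {X : A ⊗[ℂ] (B ⊗[ℂ] C)}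
    (hX : X ∈ Submodule.span ℂ
      {x | ∃ w ∈ Submodule.span ℂ ({∑ i, a i ⊗ₜ[ℂ] b i} ∪ {x | ∃ i j, i ≠ j ∧ x = a i ⊗ₜ[ℂ] b j}),
        ∃ c : C, x = (TensorProduct.assoc ℂ A B C) (w ⊗ₜ[ℂ] c)})
    (h0 : ∀ i j, i ≠ j → contract (astar i) (bstar j) X = 0) :
    X ∈ Submodule.span ℂ
      {x | ∃ w ∈ Submodule.span ℂ {∑ i, a i ⊗ₜ[ℂ] b i}, ∃ c : C,
        x = (TensorProduct.assoc ℂ A B C) (w ⊗ₜ[ℂ] c)} := by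
  suffices h : X - ∑ i, ∑ j, (if i = j then 0 else
      a i ⊗ₜ[ℂ] (b j ⊗ₜ[ℂ] contract (astar i) (bstar j) X)) ∈ Submodule.span ℂ
      {x | ∃ w ∈ Submodule.span ℂ {∑ i, a i ⊗ₜ[ℂ] b i}, ∃ c : C,
        x = (TensorProduct.assoc ℂ A B C) (w ⊗ₜ[ℂ] c)} by
    convert h
    rw [eq_comm, sub_eq_self]
    refine Finset.sum_eq_zero fun i _ => Finset.sum_eq_zero fun j _ => ?_
    split_ifs with hij
    · rfl
    · simp [h0 i j hij]
  clear h0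
  let Θ : A ⊗[ℂ] (B ⊗[ℂ] C) →ₗ[ℂ] A ⊗[ℂ] (B ⊗[ℂ] C) := LinearMap.id - ∑ i, ∑ j,
    if i = j then 0 else (TensorProduct.mk ℂ A (B ⊗[ℂ] C) (a i)) ∘ₗ
      (TensorProduct.mk ℂ B C (b j)) ∘ₗ contract (astar i) (bstar j)
  have hΘ : ∀ X, X - ∑ i, ∑ j, (if i = j then 0 else
      a i ⊗ₜ[ℂ] (b j ⊗ₜ[ℂ] contract (astar i) (bstar j) X)) = Θ X := by
    intro X
    simp only [Θ, LinearMap.sub_apply, LinearMap.id_apply, LinearMap.sum_apply]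
    congr 1
    refine Finset.sum_congr rfl fun i _ => Finset.sum_congr rfl fun j _ => ?_
    split_ifs <;> rfl
  have hΘw : ∀ c : C, Θ (TensorProduct.assoc ℂ A B C ((∑ i, a i ⊗ₜ[ℂ] b i) ⊗ₜ[ℂ] c)) =
      TensorProduct.assoc ℂ A B C ((∑ i, a i ⊗ₜ[ℂ] b i) ⊗ₜ[ℂ] c) := by
    intro c
    rw [← hΘ, sub_eq_self]
    refine Finset.sum_eq_zero fun i _ => Finset.sum_eq_zero fun j _ => ?_
    split_ifs with hij
    · rfl
    · simp [contract_assoc, hastar, hbstar, hij]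
  have hΘab : ∀ i j, i ≠ j → ∀ c : C,
      Θ (TensorProduct.assoc ℂ A B C ((a i ⊗ₜ[ℂ] b j) ⊗ₜ[ℂ] c)) = 0 := by
    intro i j hij c
    rw [← hΘ, sub_eq_zero, Finset.sum_eq_single i, Finset.sum_eq_single j]
    · simp [hij, hastar, hbstar]
    · intro k _ hk
      split_ifs <;> simp [hbstar, hk]
    · simp
    · intro k _ hk
      refine Finset.sum_eq_zero fun l _ => ?_
      split_ifs <;> simp [hastar, hk]
    · simp
  rw [hΘ]
  induction hX using Submodule.span_induction with
  | mem x hx =>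
    obtain ⟨m, hm, c, rfl⟩ := hx
    induction hm using Submodule.span_induction with
    | mem m hm =>
      rcases hm with rfl | ⟨i, j, hij, rfl⟩
      · rw [hΘw]
        exact Submodule.subset_span ⟨_, Submodule.mem_span_singleton_self _, c, rfl⟩
      · rw [hΘab i j hij]
        exact zero_mem _
    | zero => simp
    | add x y _ _ hx hy => rw [add_tmul, map_add, map_add]; exact add_mem hx hy
    | smul k x _ hx =>
      rw [← smul_tmul', map_smul, map_smul]; exact Submodule.smul_mem _ _ hx
  | zero => simp
  | add x y _ _ hx hy => rw [map_add]; exact add_mem hx hy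
  | smul k x _ hx => rw [map_smul]; exact Submodule.smul_mem _ _ hx

end Rank

section Clone

variable {A B C V : Type*} [AddCommGroup A] [Module ℂ A] [AddCommGroup B] [Module ℂ B]
  [AddCommGroup C] [Module ℂ C] [AddCommGroup V] [Module ℂ V]

@[simp] theorem cloneMap3_tmul (S : V) (x : A) (y : B) (z : C) :
    cloneMap3 S (x ⊗ₜ[ℂ] (y ⊗ₜ[ℂ] z)) = (x ⊗ₜ[ℂ] S) ⊗ₜ[ℂ] ((y ⊗ₜ[ℂ] S) ⊗ₜ[ℂ] (z ⊗ₜ[ℂ] S)) := by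
  simp [cloneMap3]

theorem cloneMap3_eq_map (S : V) (T : A ⊗[ℂ] (B ⊗[ℂ] C)) :
    cloneMap3 S T = TensorProduct.map ((TensorProduct.mk ℂ A V).flip S)
      (TensorProduct.map ((TensorProduct.mk ℂ B V).flip S) ((TensorProduct.mk ℂ C V).flip S)) T := by
  obtain ⟨n, x, y, z, rfl⟩ := exists_eq_sum_simple T
  simp

variable {θ σ : ℕ}

theorem sum_bvec_apply (φ : Fin θ → Fin σ) :
    (∑ ψ : Fin θ → Fin σ, bvec ψ : Wsp θ σ) φ = 1 := by
  simp [bvec, Finset.sum_apply, Pi.single_apply]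

variable (A) in
/-- Evaluation of the second factor of `A ⊗ W` at a multi-index. -/
noncomputable def evalAt (φ : Fin θ → Fin σ) : A ⊗[ℂ] Wsp θ σ →ₗ[ℂ] A :=
  (TensorProduct.rid ℂ A).toLinearMap ∘ₗ TensorProduct.map LinearMap.id (LinearMap.proj φ)

@[simp] theorem evalAt_tmul (φ : Fin θ → Fin σ) (x : A) (f : Wsp θ σ) :
    evalAt A φ (x ⊗ₜ[ℂ] f) = f φ • x := by
  simp [evalAt]

theorem map_evalAt_cloneMap3 (φ ψ χ : Fin θ → Fin σ) (T : A ⊗[ℂ] (B ⊗[ℂ] C)) :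
    TensorProduct.map (evalAt A φ) (TensorProduct.map (evalAt B ψ) (evalAt C χ))
      (cloneMap3 (∑ φ : Fin θ → Fin σ, bvec φ) T) = T := by
  obtain ⟨n, x, y, z, rfl⟩ := exists_eq_sum_simple T
  simp only [map_sum, cloneMap3_tmul, map_tmul, evalAt_tmul, sum_bvec_apply, one_smul]

theorem evalPair_blockOf (f : Module.Dual ℂ A) (g : Module.Dual ℂ B) (φ ψ : Fin θ → Fin σ)
    (m : (A ⊗[ℂ] Wsp θ σ) ⊗[ℂ] (B ⊗[ℂ] Wsp θ σ)) :
    evalPair φ ψ (blockOf f g m) =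
      TensorProduct.dualDistrib ℂ _ _ ((f ∘ₗ evalAt A φ) ⊗ₜ[ℂ] (g ∘ₗ evalAt B ψ)) m := by
  have key : evalPair φ ψ ∘ₗ TensorProduct.map
      ((TensorProduct.lid ℂ (Wsp θ σ)).toLinearMap ∘ₗ TensorProduct.map f LinearMap.id)
      ((TensorProduct.lid ℂ (Wsp θ σ)).toLinearMap ∘ₗ TensorProduct.map g LinearMap.id) =
      TensorProduct.dualDistrib ℂ _ _ ((f ∘ₗ evalAt A φ) ⊗ₜ[ℂ] (g ∘ₗ evalAt B ψ)) := by
    refine TensorProduct.ext' fun x y => ?_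
    induction x with
    | zero => simp
    | add x y hx hy => rw [add_tmul, map_add, map_add, hx, hy]
    | tmul x v =>
      induction y with
      | zero => simp
      | add x y hx hy => rw [tmul_add, map_add, map_add, hx, hy]
      | tmul y v' => simp [evalPair]; ring
  exact LinearMap.congr_fun key m

end Clone

section PhiLemmas

variable {A B : Type*} [AddCommGroup A] [Module ℂ A] [AddCommGroup B] [Module ℂ B]
  {r θ σ : ℕ} {a : Fin r → A} {b : Fin r → B} {π : Fin r → Fin θ → Bool}
  {astar : Fin r → Module.Dual ℂ A} {bstar : Fin r → Module.Dual ℂ B}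

theorem dualDistrib_PhiTensor (hastar : ∀ i k, astar i (a k) = if i = k then 1 else 0)
    (hbstar : ∀ j k, bstar j (b k) = if j = k then 1 else 0) (i j : Fin r)
    (φ ψ : Fin θ → Fin σ) (Φ : Fin θ → Fin σ × Fin σ) :
    TensorProduct.dualDistrib ℂ _ _ ((astar i ∘ₗ evalAt A φ) ⊗ₜ[ℂ] (bstar j ∘ₗ evalAt B ψ))
      (PhiTensor a b π Φ) =
      (if φ = fun γ => sel (Φ γ) (π i γ) then 1 else 0) *
        (if ψ = fun γ => sel (Φ γ) (!(π j γ)) then 1 else 0) := by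
  simp only [PhiTensor, dualDistrib_apply, LinearMap.comp_apply, map_sum, evalAt_tmul, map_smul,
    hastar, hbstar, bvec, Pi.single_apply, smul_eq_mul, mul_ite, mul_one, mul_zero,
    Finset.sum_ite_eq, Finset.mem_univ, if_true]

theorem tmul_bvec_mem_Uset (hastar : ∀ i k, astar i (a k) = if i = k then 1 else 0)
    (hbstar : ∀ j k, bstar j (b k) = if j = k then 1 else 0) {i j : Fin r} (hij : i ≠ j)
    (Φ : Fin θ → Fin σ × Fin σ) :
    (a i ⊗ₜ[ℂ] bvec (fun γ => sel (Φ γ) (π i γ))) ⊗ₜ[ℂ]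
      (b j ⊗ₜ[ℂ] bvec (fun γ => sel (Φ γ) (!(π j γ)))) ∈ Uset a b π astar bstar := by
  refine ⟨i, j, hij, _, _, ⟨Φ, ?_⟩, rfl⟩
  rw [evalPair_blockOf, dualDistrib_PhiTensor hastar hbstar]
  simp

/-- The reindexing of functions `Φ` by pairs of multi-indices given by the diagonal block `i`. -/
def selEquiv (ε : Fin θ → Bool) :
    (Fin θ → Fin σ × Fin σ) ≃ (Fin θ → Fin σ) × (Fin θ → Fin σ) where
  toFun Φ := (fun γ => sel (Φ γ) (ε γ), fun γ => sel (Φ γ) (!(ε γ)))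
  invFun p γ := if ε γ then (p.1 γ, p.2 γ) else (p.2 γ, p.1 γ)
  left_inv Φ := by
    funext γ
    cases h : ε γ <;> simp [h, sel]
  right_inv p := by
    ext γ <;> cases h : ε γ <;> simp [h, sel]

theorem sum_clone_mem_Msp (hastar : ∀ i k, astar i (a k) = if i = k then 1 else 0)
    (hbstar : ∀ j k, bstar j (b k) = if j = k then 1 else 0) :
    ∑ i, (a i ⊗ₜ[ℂ] (∑ φ : Fin θ → Fin σ, bvec φ)) ⊗ₜ[ℂ]
      (b i ⊗ₜ[ℂ] (∑ φ : Fin θ → Fin σ, bvec φ)) ∈ Msp (σ := σ) a b π astar bstar := by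
  have hdiag : ∀ i, (a i ⊗ₜ[ℂ] (∑ φ : Fin θ → Fin σ, bvec φ)) ⊗ₜ[ℂ]
      (b i ⊗ₜ[ℂ] (∑ φ : Fin θ → Fin σ, bvec φ)) =
      ∑ Φ : Fin θ → Fin σ × Fin σ, (a i ⊗ₜ[ℂ] bvec (fun γ => sel (Φ γ) (π i γ))) ⊗ₜ[ℂ]
        (b i ⊗ₜ[ℂ] bvec (fun γ => sel (Φ γ) (!(π i γ)))) := by
    intro i
    rw [tmul_sum, tmul_sum, sum_tmul]
    simp_rw [tmul_sum]
    rw [← Fintype.sum_prod_type' (f := fun φ ψ : Fin θ → Fin σ =>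
      (a i ⊗ₜ[ℂ] bvec φ) ⊗ₜ[ℂ] (b i ⊗ₜ[ℂ] bvec ψ))]
    exact ((selEquiv (π i)).sum_comp fun p : (Fin θ → Fin σ) × (Fin θ → Fin σ) =>
      (a i ⊗ₜ[ℂ] bvec p.1) ⊗ₜ[ℂ] (b i ⊗ₜ[ℂ] bvec p.2)).symm
  simp_rw [hdiag]
  rw [Finset.sum_comm]
  refine Submodule.sum_mem _ fun Φ _ => ?_
  have hΦ : PhiTensor a b π Φ ∈ Msp a b π astar bstar :=
    Submodule.subset_span (Or.inl ⟨Φ, rfl⟩)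
  have hoff : ∑ i, ∑ j ∈ Finset.univ.erase i,
      (a i ⊗ₜ[ℂ] bvec (fun γ => sel (Φ γ) (π i γ))) ⊗ₜ[ℂ]
        (b j ⊗ₜ[ℂ] bvec (fun γ => sel (Φ γ) (!(π j γ)))) ∈ Msp a b π astar bstar :=
    Submodule.sum_mem _ fun i _ => Submodule.sum_mem _ fun j hj => Submodule.subset_span
      (Or.inr (tmul_bvec_mem_Uset hastar hbstar (Finset.ne_of_mem_erase hj).symm Φ))
  convert sub_mem hΦ hoff
  rw [PhiTensor, sum_tmul, ← Finset.sum_sub_distrib]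
  refine Finset.sum_congr rfl fun i _ => ?_
  rw [tmul_sum, ← Finset.add_sum_erase _ _ (Finset.mem_univ i), add_sub_cancel_right]

theorem dualDistrib_eq_zero_of_mem_Msp (hastar : ∀ i k, astar i (a k) = if i = k then 1 else 0)
    (hbstar : ∀ j k, bstar j (b k) = if j = k then 1 else 0) (hπ : Function.Injective π)
    {i j : Fin r} (hij : i ≠ j) {u v : Fin σ} (huv : u ≠ v)
    {m : (A ⊗[ℂ] Wsp θ σ) ⊗[ℂ] (B ⊗[ℂ] Wsp θ σ)} (hm : m ∈ Msp a b π astar bstar) :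
    TensorProduct.dualDistrib ℂ _ _ ((astar i ∘ₗ evalAt A (fun _ : Fin θ => u)) ⊗ₜ[ℂ]
      (bstar j ∘ₗ evalAt B (fun _ : Fin θ => v))) m = 0 := by
  have hPhi : ∀ Φ, TensorProduct.dualDistrib ℂ _ _ ((astar i ∘ₗ evalAt A (fun _ : Fin θ => u)) ⊗ₜ[ℂ]
      (bstar j ∘ₗ evalAt B (fun _ : Fin θ => v))) (PhiTensor a b π Φ) = 0 := by
    intro Φ
    rw [dualDistrib_PhiTensor hastar hbstar]
    split_ifs with h1 h2
    · obtain ⟨γ, hγ⟩ := Function.ne_iff.mp (hπ.ne hij)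
      refine absurd ?_ huv
      have h1 := congrFun h1 γ
      have h2 := congrFun h2 γ
      rw [← Bool.eq_not_of_ne hγ] at h2
      exact h1.trans h2.symm
    all_goals simp
  induction hm using Submodule.span_induction with
  | mem x hx =>
    rcases hx with ⟨Φ, rfl⟩ | ⟨i', j', hij', φ, ψ, ⟨Φ, h⟩, rfl⟩
    · exact hPhi Φ
    · by_contra hne
      simp only [dualDistrib_apply, LinearMap.comp_apply, evalAt_tmul, map_smul, hastar, hbstar,
        bvec, Pi.single_apply, smul_eq_mul] at hne
      obtain ⟨⟨hφ, hi⟩, hψ, hj⟩ : ((fun _ => u) = φ ∧ i = i') ∧ (fun _ => v) = ψ ∧ j = j' := by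
        simp only [mul_ite, mul_one, mul_zero, ite_eq_right_iff, one_ne_zero, imp_false,
          not_not, Classical.not_imp] at hne
        tauto
      subst hi hj hφ hψ
      rw [evalPair_blockOf] at h
      exact h (hPhi Φ)
  | zero => simp
  | add x y _ _ hx hy => rw [map_add, hx, hy, add_zero]
  | smul k x _ hx => rw [map_smul, hx, smul_zero]

theorem Msp_le_comap_map_evalAt (u : Fin σ) :
    Msp a b π astar bstar ≤ (Submodule.span ℂ
      ({∑ i, a i ⊗ₜ[ℂ] b i} ∪ {x | ∃ i j, i ≠ j ∧ x = a i ⊗ₜ[ℂ] b j})).comap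
      (TensorProduct.map (evalAt A (fun _ : Fin θ => u)) (evalAt B (fun _ : Fin θ => u))) := by
  refine Submodule.span_le.mpr ?_
  have hab : ∀ i j, i ≠ j → a i ⊗ₜ[ℂ] b j ∈ Submodule.span ℂ
      ({∑ i, a i ⊗ₜ[ℂ] b i} ∪ {x | ∃ i j, i ≠ j ∧ x = a i ⊗ₜ[ℂ] b j}) := fun i j hij =>
    Submodule.subset_span (Or.inr ⟨i, j, hij, rfl⟩)
  rintro x (⟨Φ, rfl⟩ | ⟨i, j, hij, φ, ψ, -, rfl⟩)
  · simp only [PhiTensor, Submodule.comap_coe, Set.mem_preimage, map_tmul, map_sum, evalAt_tmul,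
      SetLike.mem_coe]
    rw [sum_tmul]
    have hdiag : ∀ i : Fin r, (bvec (fun γ => sel (Φ γ) (π i γ)) : Wsp θ σ) (fun _ => u) *
        (bvec (fun γ => sel (Φ γ) (!(π i γ))) : Wsp θ σ) (fun _ => u) =
        if Φ = fun _ => (u, u) then 1 else 0 := by
      intro i
      have : Φ = (fun _ => (u, u)) ↔ ((fun _ => u) = (fun γ => sel (Φ γ) (π i γ)) ∧
          (fun _ => u) = (fun γ => sel (Φ γ) (!(π i γ)))) := by
        rw [← (selEquiv (π i)).apply_eq_iff_eq, Prod.ext_iff]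
        have hs : ∀ e : Bool, sel (u, u) e = u := fun e => by cases e <;> rfl
        simp only [selEquiv, Equiv.coe_fn_mk, hs]
        rw [eq_comm (a := fun _ => u), eq_comm (a := fun _ => u)]
      simp only [bvec, Pi.single_apply, this, ite_and, mul_ite, mul_one, mul_zero]
      split_ifs <;> rfl
    have hsplit : ∀ i : Fin r, ((bvec (fun γ => sel (Φ γ) (π i γ)) : Wsp θ σ) (fun _ => u) • a i)
        ⊗ₜ[ℂ] (∑ j, (bvec (fun γ => sel (Φ γ) (!(π j γ))) : Wsp θ σ) (fun _ => u) • b j) =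
        (if Φ = fun _ => (u, u) then (1 : ℂ) else 0) • a i ⊗ₜ[ℂ] b i +
        ∑ j ∈ Finset.univ.erase i, ((bvec (fun γ => sel (Φ γ) (π i γ)) : Wsp θ σ) (fun _ => u) *
        (bvec (fun γ => sel (Φ γ) (!(π j γ))) : Wsp θ σ) (fun _ => u)) • a i ⊗ₜ[ℂ] b j := by
      intro i
      rw [← hdiag i, Finset.add_sum_erase _ (fun j =>
        ((bvec (fun γ => sel (Φ γ) (π i γ)) : Wsp θ σ) (fun _ => u) *
        (bvec (fun γ => sel (Φ γ) (!(π j γ))) : Wsp θ σ) (fun _ => u)) • a i ⊗ₜ[ℂ] b j)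
        (Finset.mem_univ i), tmul_sum]
      exact Finset.sum_congr rfl fun j _ => by rw [smul_tmul_smul]
    simp_rw [hsplit]
    rw [Finset.sum_add_distrib, ← Finset.smul_sum]
    refine add_mem (Submodule.smul_mem _ _ (Submodule.subset_span (Or.inl rfl)))
      (Submodule.sum_mem _ fun i _ => Submodule.sum_mem _ fun j hj => Submodule.smul_mem _ _
        (hab i j (Finset.ne_of_mem_erase hj).symm))
  · simp only [Submodule.comap_coe, Set.mem_preimage, map_tmul, evalAt_tmul, SetLike.mem_coe,
      smul_tmul_smul]
    exact Submodule.smul_mem _ _ (hab i j hij)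

end PhiLemmas

/-- A matrix of rank at most `n` which is a constant matrix plus a diagonal matrix has at most
`n + 1` positions at which the diagonal matrix is nonzero. -/
theorem card_filter_ne_zero_le {C ι : Type*} [AddCommGroup C] [Module ℂ C] [Fintype ι]
    [DecidableEq ι] [DecidableEq C] {n : ℕ} (x : ι → Fin n → ℂ) (y : ι → Fin n → C) (t : C) (d : ι → C)
    (h : ∀ u v, ∑ k, x u k • y v k = t + if u = v then d u else 0) :
    (Finset.univ.filter fun u => d u ≠ 0).card ≤ n + 1 := by
  let Z := Finset.univ.filter fun u => d u ≠ 0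
  have hli : LinearIndependent ℂ fun u : Z => ((1 : ℂ), x u) := by
    rw [Fintype.linearIndependent_iff]
    intro g hg v
    obtain ⟨h1, h2⟩ := Prod.ext_iff.mp hg
    simp only [Prod.fst_sum, Prod.snd_sum, Prod.smul_mk, smul_eq_mul, mul_one, Prod.fst_zero,
      Prod.snd_zero] at h1 h2
    have h3 : ∑ u : Z, g u • ∑ k, x u k • y v k = 0 := by
      simp_rw [Finset.smul_sum, smul_smul]
      rw [Finset.sum_comm]
      refine Finset.sum_eq_zero fun k _ => ?_
      rw [← Finset.sum_smul]
      have := congrFun h2 k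
      simp only [Finset.sum_apply, Pi.smul_apply, smul_eq_mul, Pi.zero_apply] at this
      rw [this, zero_smul]
    simp_rw [h, smul_add] at h3
    rw [Finset.sum_add_distrib, ← Finset.sum_smul, h1, zero_smul, zero_add,
      Finset.sum_eq_single v] at h3
    · rw [if_pos rfl, smul_eq_zero] at h3
      exact h3.resolve_right (Finset.mem_filter.mp v.2).2
    · intro u _ hu
      rw [if_neg (fun h => hu (Subtype.ext h)), smul_zero]
    · simp
  have hcard := hli.fintype_card_le_finrank
  rwa [Fintype.card_coe, Module.finrank_prod, Module.finrank_self, Module.finrank_fin_fun,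
    add_comm] at hcard

/-- **Minimum modification rank is preserved by cloning.** In the Φ-tensor construction,
for every tensor `T ∈ A⊗B⊗C`,
`min R(T^{Σ_θ} mod (0,0,𝓜)) = min R(T mod (0,0,⟨w⟩))`. -/
theorem minModRank_clone_eq
    (A B C : Type*) [AddCommGroup A] [Module ℂ A] [FiniteDimensional ℂ A]
    [AddCommGroup B] [Module ℂ B] [FiniteDimensional ℂ B]
    [AddCommGroup C] [Module ℂ C] [FiniteDimensional ℂ C]
    (r ρ θ σ : ℕ) (hr : 0 < r)
    (hρ : ρ = 2 * Module.finrank ℂ A * Module.finrank ℂ B * Module.finrank ℂ C + 1)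
    (hθ : θ = Nat.clog 2 r) (hσ : σ = 2 * ρ ^ 2 * r)
    (a : Fin r → A) (b : Fin r → B)
    (ha : LinearIndependent ℂ a) (hb : LinearIndependent ℂ b)
    (w : A ⊗[ℂ] B) (hw : w = ∑ i, a i ⊗ₜ[ℂ] b i)
    (π : Fin r → Fin θ → Bool) (hπ : Function.Injective π)
    (astar : Fin r → Module.Dual ℂ A) (bstar : Fin r → Module.Dual ℂ B)
    (hastar : ∀ i k, astar i (a k) = if i = k then 1 else 0)
    (hbstar : ∀ j k, bstar j (b k) = if j = k then 1 else 0)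
    (T : A ⊗[ℂ] (B ⊗[ℂ] C)) :
    minModRankC (cloneMap3 (∑ φ : Fin θ → Fin σ, bvec φ) T)
        (Msp (σ := σ) a b π astar bstar)
      = minModRankC T (Submodule.span ℂ {w}) := by
  subst hw
  set N := Module.finrank ℂ A * Module.finrank ℂ B * Module.finrank ℂ C with hN
  have hle : minModRankC (cloneMap3 (∑ φ : Fin θ → Fin σ, bvec φ) T)
      (Msp (σ := σ) a b π astar bstar)
      ≤ minModRankC T (Submodule.span ℂ {∑ i, a i ⊗ₜ[ℂ] b i}) := by
    obtain ⟨T', ⟨X, hX, rfl⟩, hT'⟩ :=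
      exists_tRank3_eq_minModRankC T (Submodule.span ℂ {∑ i, a i ⊗ₜ[ℂ] b i})
    rw [← hT']
    refine (minModRankC_le (T' := cloneMap3 (∑ φ : Fin θ → Fin σ, bvec φ) (T + X)) ?_).trans ?_
    · refine ⟨cloneMap3 (∑ φ : Fin θ → Fin σ, bvec φ) X, ?_, map_add _ _ _⟩
      rw [cloneMap3_eq_map]
      refine map_mem_span_assoc _ ?_ hX
      rw [Submodule.span_singleton_le_iff_mem, Submodule.mem_comap, map_sum]
      exact sum_clone_mem_Msp hastar hbstar
    · rw [cloneMap3_eq_map]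
      exact tRank3_map_le _ _ _ _
  refine hle.antisymm ?_
  have hRT : minModRankC T (Submodule.span ℂ {∑ i, a i ⊗ₜ[ℂ] b i}) ≤ N :=
    (minModRankC_le (self_mem_modSetC _ _)).trans (tRank3_le_finrank_mul T)
  rcases Nat.eq_zero_or_pos N with hN0 | hNpos
  · exact (hRT.trans hN0.le).trans (Nat.zero_le _)
  obtain ⟨Y, ⟨X, hX, hY⟩, hYR⟩ := exists_tRank3_eq_minModRankC
    (cloneMap3 (∑ φ : Fin θ → Fin σ, bvec φ) T) (Msp (σ := σ) a b π astar bstar)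
  have hRN : tRank3 Y ≤ N := hYR.le.trans (hle.trans hRT)
  rw [← hYR]
  have hrN : r ≤ N := by
    have h1 : r ≤ Module.finrank ℂ A := by simpa using ha.fintype_card_le_finrank
    rw [hN, mul_assoc] at hNpos ⊢
    exact h1.trans (Nat.le_mul_of_pos_right _ (Nat.pos_of_mul_pos_left hNpos))
  have hcard : r * r * (N + 1) < σ := by
    have hρN : ρ = 2 * N + 1 := by rw [hρ, hN]; ring
    rw [hσ, hρN]
    nlinarith [Nat.mul_le_mul hrN (le_refl (r * (N + 1))), Nat.mul_pos hr hNpos,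
      Nat.mul_pos (Nat.mul_pos hr hNpos) hNpos]
  classical
  let χ : Fin θ → Fin σ := fun _ => ⟨0, by omega⟩
  -- the off-diagonal contributions of the modification on constant multi-indices
  let d : Fin r → Fin r → Fin σ → C := fun i j u => evalAt C χ (contract
    (astar i ∘ₗ evalAt A (fun _ : Fin θ => u)) (bstar j ∘ₗ evalAt B (fun _ : Fin θ => u)) X)
  have hd : ∀ i j, i ≠ j → (Finset.univ.filter fun u => d i j u ≠ 0).card ≤ N + 1 := by
    intro i j hij
    obtain ⟨x, y, z, hxyz⟩ := exists_eq_sum_tRank3 Y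
    refine (card_filter_ne_zero_le
      (fun u k => astar i (evalAt A (fun _ : Fin θ => u) (x k)))
      (fun v k => bstar j (evalAt B (fun _ : Fin θ => v) (y k)) • evalAt C χ (z k))
      (contract (astar i) (bstar j) T) (d i j) ?_).trans (by omega)
    intro u v
    have h1 : evalAt C χ (contract (astar i ∘ₗ evalAt A (fun _ : Fin θ => u))
        (bstar j ∘ₗ evalAt B (fun _ : Fin θ => v)) Y) = contract (astar i) (bstar j) T +
        evalAt C χ (contract (astar i ∘ₗ evalAt A (fun _ : Fin θ => u))
          (bstar j ∘ₗ evalAt B (fun _ : Fin θ => v)) X) := by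
      rw [hY, map_add, map_add, ← contract_map, map_evalAt_cloneMap3]
    have h2 : evalAt C χ (contract (astar i ∘ₗ evalAt A (fun _ : Fin θ => u))
        (bstar j ∘ₗ evalAt B (fun _ : Fin θ => v)) Y) =
        ∑ k, astar i (evalAt A (fun _ : Fin θ => u) (x k)) •
          bstar j (evalAt B (fun _ : Fin θ => v) (y k)) • evalAt C χ (z k) := by
      conv_lhs => rw [hxyz]
      simp only [map_sum, contract_tmul, LinearMap.comp_apply, map_smul]
    rw [← h2, h1]
    congr 1
    split_ifs with huv
    · subst huv; rfl
    · rw [contract_eq_zero (fun m hm =>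
        dualDistrib_eq_zero_of_mem_Msp hastar hbstar hπ hij huv hm) hX, map_zero]
  obtain ⟨u, hu⟩ : ∃ u : Fin σ, ∀ i j, i ≠ j → d i j u = 0 := by
    by_contra! hcon
    have hsub : (Finset.univ : Finset (Fin σ)) ⊆ Finset.univ.biUnion fun p : Fin r × Fin r =>
        if p.1 = p.2 then ∅ else Finset.univ.filter fun u => d p.1 p.2 u ≠ 0 := by
      intro u _
      obtain ⟨i, j, hij, h⟩ := hcon u
      exact Finset.mem_biUnion.mpr ⟨(i, j), Finset.mem_univ _, by simp [hij, h]⟩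
    have h1 := (Finset.card_le_card hsub).trans
      (Finset.card_biUnion_le_card_mul _ _ (N + 1) fun p _ => by
        split_ifs with hp
        · simp
        · exact hd _ _ hp)
    simp at h1
    omega
  have hmod : TensorProduct.map (evalAt A fun _ : Fin θ => u) (TensorProduct.map
      (evalAt B fun _ : Fin θ => u) (evalAt C χ)) Y ∈
      modSetC T (Submodule.span ℂ {∑ i, a i ⊗ₜ[ℂ] b i}) := by
    refine ⟨TensorProduct.map (evalAt A fun _ : Fin θ => u) (TensorProduct.map
      (evalAt B fun _ : Fin θ => u) (evalAt C χ)) X, ?_, ?_⟩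
    · refine mem_span_assoc_of_contract_eq_zero hastar hbstar
        (map_mem_span_assoc _ (Msp_le_comap_map_evalAt u) hX) fun i j hij => ?_
      rw [contract_map]
      exact hu i j hij
    · rw [hY, map_add, map_evalAt_cloneMap3]
  exact (minModRankC_le hmod).trans (tRank3_map_le _ _ _ _)
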